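/- Let n, k be positive integers with k+1 coprime to n, let F be a field whose characteristic does not divide n containing a primitive n-th root of unity ω, and let φ : ℤ_n^k → F be an alternating function. For a ∈ ℤ_n define f_a : ℤ_n^k → F by f_a(x_1,…,x_k) = φ(x_1,…,x_k) + ∑_{i=1}^k (−1)^i φ(a − ∑_{j=1}^k x_j, x_1,…,x̂_i,…,x_k). Then for every u = (u_1,…,u_k) ∈ ℤ_n^k, the Fourier transform satisfies f̂_a(u) = φ̂(u) + ∑_{i=1}^{k} (−1)^{ki} e(−u_i a) φ̂(T^i u). -/

import Mathlib

open scoped BigOperators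

/-- `e(x) = ω^x` for `x ∈ ℤ_n`. -/
noncomputable def eF (n : ℕ) [NeZero n] (F : Type*) [Field F] (ω : F) (x : ZMod n) : F :=
  ω ^ x.val

/-- A function `φ : ℤ_n^k → F` is alternating: permuting the coordinates multiplies the
value by the sign of the permutation, and the value vanishes on tuples with a repeated
coordinate. -/
def IsAlt (n : ℕ) [NeZero n] (F : Type*) [Field F] (k : ℕ)
    (φ : (Fin k → ZMod n) → F) : Prop :=
  (∀ (π : Equiv.Perm (Fin k)) (v : Fin k → ZMod n),
      φ (v ∘ π) = (Equiv.Perm.sign π : ℤ) • φ v) ∧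
  (∀ v : Fin k → ZMod n, ¬ Function.Injective v → φ v = 0)

/-- The Fourier transform of `φ : ℤ_n^k → F`:
`φ̂(u) = ∑_x φ(x) e(-∑_j u_j x_j)`. -/
noncomputable def fourierT (n : ℕ) [NeZero n] (F : Type*) [Field F] (ω : F) (k : ℕ)
    (φ : (Fin k → ZMod n) → F) : (Fin k → ZMod n) → F :=
  fun u => ∑ x : Fin k → ZMod n, φ x * eF n F ω (-(∑ j, u j * x j))

/-- Deletion of the `i`-th coordinate of a `k`-tuple (0-indexed). -/
def delCoord (n : ℕ) {k : ℕ} (i : Fin k) (v : Fin k → ZMod n) : Fin (k - 1) → ZMod n :=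
  fun j =>
    if h : (j : ℕ) < (i : ℕ) then v ⟨(j : ℕ), lt_trans h i.isLt⟩
    else v ⟨(j : ℕ) + 1, by have := j.isLt; omega⟩

/-- The automorphism `T` of `ℤ_n^k`:
`T(u_1,…,u_k) = (u_2 - u_1, …, u_k - u_1, -u_1)` (0-indexed). -/
def Ttrans (n k : ℕ) (u : Fin k → ZMod n) : Fin k → ZMod n :=
  fun i =>
    (if h : (i : ℕ) + 1 < k then u ⟨(i : ℕ) + 1, h⟩ else 0) -
      u ⟨0, Nat.lt_of_le_of_lt (Nat.zero_le _) i.isLt⟩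

/-- The tuple `(a - ∑_j x_j, x_1, …, x̂_i, …, x_k)` obtained from the `k`-tuple `x` by
removing its `i`-th coordinate (0-indexed) and prepending `a - ∑_j x_j`. -/
def insTuple (n : ℕ) [NeZero n] (a : ZMod n) {k : ℕ} (i : Fin k)
    (x : Fin k → ZMod n) : Fin k → ZMod n :=
  fun j =>
    if (j : ℕ) = 0 then a - ∑ t, x t
    else if (j : ℕ) ≤ (i : ℕ) then x ⟨(j : ℕ) - 1, by have := j.isLt; omega⟩
    else x j

/-- The `k`-tuple `(c, x_1, …, x̂_i, …, x_k)`. -/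
def prependErase {α : Type*} {k : ℕ} (c : α) (i : Fin k) (x : Fin k → α) : Fin k → α :=
  fun j =>
    if (j : ℕ) = 0 then c
    else if (j : ℕ) ≤ (i : ℕ) then x ⟨(j : ℕ) - 1, by have := j.isLt; omega⟩
    else x j

theorem prependErase_comp_cycleRange {α : Type*} {k : ℕ} (c : α) (i : Fin k)
    (x : Fin k → α) :
    prependErase c i x ∘ i.cycleRange = Function.update x i c := by
  have : NeZero k := ⟨by have := i.isLt; omega⟩
  funext j
  rcases lt_trichotomy j i with h | rfl | h
  · have hv : (i.cycleRange j : ℕ) = j + 1 := Fin.coe_cycleRange_of_lt h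
    have h' : (j : ℕ) < i := h
    simp only [Function.comp_apply, prependErase, hv, Function.update_of_ne h.ne]
    simp [Nat.succ_le_of_lt h']
  · simp [prependErase, Fin.cycleRange_self]
  · have h' : (i : ℕ) < j := h
    simp only [Function.comp_apply, prependErase, Fin.cycleRange_of_gt h,
      Function.update_of_ne h.ne']
    rw [if_neg (by omega), if_neg (by omega)]

theorem val_finRotate_pow_apply {k : ℕ} (m : ℕ) (j : Fin k) :
    (((finRotate k) ^ m) j : ℕ) = (j + m) % k := by
  cases k with
  | zero => exact j.elim0
  | succ k =>
    induction m with
    | zero => simp [Nat.mod_eq_of_lt j.isLt]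
    | succ m ih =>
      rw [pow_succ', Equiv.Perm.mul_apply, finRotate_apply, Fin.val_add, ih,
        Fin.val_one', ← Nat.add_mod, add_assoc]

theorem Ttrans_iterate_succ_apply {n k : ℕ} (u : Fin k → ZMod n) (m : ℕ) (hm : m < k)
    (j : Fin k) :
    (Ttrans n k)^[m + 1] u j =
      (if h : (j : ℕ) + m + 1 < k then u ⟨j + m + 1, h⟩
        else if (j : ℕ) + m + 1 = k then 0
        else u ⟨j + m - k, by have := j.isLt; omega⟩) - u ⟨m, hm⟩ := by
  induction m generalizing j with
  | zero =>
    have := j.isLt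
    simp only [zero_add, Function.iterate_one, Ttrans, add_zero]
    split_ifs
    · rfl
    · rfl
    · omega
  | succ m ih =>
    have hj := j.isLt
    rw [Function.iterate_succ_apply', Ttrans, ih (by omega) ⟨0, by omega⟩,
      dif_pos (show 0 + m + 1 < k by omega)]
    by_cases h₁ : (j : ℕ) + 1 < k
    · rw [dif_pos h₁, ih (by omega), sub_sub_sub_cancel_right]
      congr 1
      · simp only [show (j : ℕ) + 1 + m + 1 = j + (m + 1) + 1 by omega,
          show (j : ℕ) + 1 + m - k = j + (m + 1) - k by omega]
      · congr 2
        dsimp only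
        omega
    · rw [dif_neg h₁, dif_neg (by omega), if_neg (by omega), zero_sub, neg_sub]
      congr 1
      · congr 2
        omega
      · congr 2
        dsimp only
        omega

theorem Ttrans_iterate_eq_comp_finRotate_pow {n k : ℕ} (u : Fin k → ZMod n) (i : Fin k) :
    (Ttrans n k)^[(i : ℕ) + 1] u =
      (fun j => prependErase 0 i u j - u i) ∘ ⇑((finRotate k) ^ ((i : ℕ) + 1)) := by
  funext j
  have hi := i.isLt
  have hj := j.isLt
  rw [Ttrans_iterate_succ_apply u i hi j]
  simp only [Function.comp_apply, Fin.eta, prependErase, val_finRotate_pow_apply]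
  congr 1
  by_cases h₁ : (j : ℕ) + i + 1 < k
  · have hv : (j + ((i : ℕ) + 1)) % k = j + i + 1 := Nat.mod_eq_of_lt (by omega)
    rw [dif_pos h₁, if_neg (by omega), if_neg (by omega)]
    congr 1
    ext
    rw [val_finRotate_pow_apply, hv]
  · have hv : (j + ((i : ℕ) + 1)) % k = j + i + 1 - k := by
      rw [Nat.mod_eq_sub_mod (by omega), Nat.mod_eq_of_lt (by omega), add_assoc]
    rw [dif_neg h₁]
    by_cases h₂ : (j : ℕ) + i + 1 = k
    · rw [if_pos h₂, if_pos (by omega)]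
    · rw [if_neg h₂, if_neg (by omega), if_pos (by omega)]
      congr 2
      omega

theorem eF_add {n : ℕ} [NeZero n] {F : Type*} [Field F] {ω : F} (hω : ω ^ n = 1)
    (x y : ZMod n) : eF n F ω (x + y) = eF n F ω x * eF n F ω y := by
  rw [eF, eF, eF, ZMod.val_add, ← pow_eq_pow_mod _ hω, pow_add]

theorem fourierT_comp_perm {n k : ℕ} [NeZero n] {F : Type*} [Field F] (ω : F)
    {φ : (Fin k → ZMod n) → F} (hφ : IsAlt n F k φ) (π : Equiv.Perm (Fin k))
    (v : Fin k → ZMod n) :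
    fourierT n F ω k φ (v ∘ π) = ((Equiv.Perm.sign π : ℤ) : F) * fourierT n F ω k φ v := by
  rw [fourierT, fourierT, Finset.mul_sum]
  refine (Fintype.sum_equiv (Equiv.arrowCongr π.symm (Equiv.refl (ZMod n))) _ _ ?_).symm
  intro x
  have hx : Equiv.arrowCongr π.symm (Equiv.refl (ZMod n)) x = x ∘ π := rfl
  rw [hx, hφ.1 π x, zsmul_eq_mul, mul_assoc]
  simp only [Function.comp_apply]
  rw [Equiv.sum_comp π fun j => v j * x j]

theorem sum_mul_update {R : Type*} [CommRing R] {ι : Type*} [Fintype ι] [DecidableEq ι]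
    (u x : ι → R) (i : ι) (c : R) :
    ∑ j, u j * Function.update x i c j = u i * c + (∑ j, u j * x j - u i * x i) := by
  rw [← Finset.add_sum_erase _ _ (Finset.mem_univ i),
    ← Finset.add_sum_erase _ (fun j => u j * x j) (Finset.mem_univ i),
    Function.update_self, add_sub_cancel_left]
  congr 1
  refine Finset.sum_congr rfl fun j hj => ?_
  rw [Function.update_of_ne (Finset.ne_of_mem_erase hj)]

theorem involutive_update_sub_sum {R : Type*} [CommRing R] {ι : Type*} [Fintype ι]
    [DecidableEq ι] (a : R) (i : ι) :
    Function.Involutive fun x : ι → R => Function.update x i (a - ∑ t, x t) := by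
  intro x
  have h := sum_mul_update 1 x i (a - ∑ t, x t)
  simp only [Pi.one_apply, one_mul] at h
  simp only [h, Function.update_idem]
  convert Function.update_eq_self i x using 2
  ring

/-- The Fourier transform of `x ↦ φ (x_1, …, a - ∑_j x_j, …, x_k)`, with the new entry in
position `i`. -/
theorem fourierT_comp_update {n k : ℕ} [NeZero n] {F : Type*} [Field F] {ω : F}
    (hω : ω ^ n = 1) (φ : (Fin k → ZMod n) → F) (a : ZMod n) (i : Fin k)
    (u : Fin k → ZMod n) :
    fourierT n F ω k (fun x => φ (Function.update x i (a - ∑ t, x t))) u =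
      eF n F ω (-(u i * a)) *
        fourierT n F ω k φ (fun j => Function.update u i 0 j - u i) := by
  rw [fourierT, fourierT, Finset.mul_sum]
  refine Fintype.sum_equiv ((involutive_update_sub_sum a i).toPerm _) _ _ fun x => ?_
  set y := (involutive_update_sub_sum a i).toPerm _ x with hy
  have hx : x = Function.update y i (a - ∑ t, y t) :=
    ((involutive_update_sub_sum a i) x).symm
  have hφy : φ (Function.update x i (a - ∑ t, x t)) = φ y := rfl
  have hexp : -(∑ j, u j * x j) =
      -(u i * a) + -(∑ j, (Function.update u i 0 j - u i) * y j) := by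
    have h := sum_mul_update y u i 0
    simp only [mul_comm (y _)] at h
    simp only [sub_mul, Finset.sum_sub_distrib, h, ← Finset.mul_sum]
    rw [hx, sum_mul_update]
    ring
  simp only [hφy, hexp, eF_add hω]
  ring

theorem fourierT_comp_insTuple {n k : ℕ} [NeZero n] {F : Type*} [Field F] {ω : F}
    (hω : ω ^ n = 1) {φ : (Fin k → ZMod n) → F} (hφ : IsAlt n F k φ) (a : ZMod n)
    (i : Fin k) (u : Fin k → ZMod n) :
    fourierT n F ω k (fun x => φ (insTuple n a i x)) u =
      (-1) ^ ((k - 1) * ((i : ℕ) + 1)) * eF n F ω (-(u i * a)) *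
        fourierT n F ω k φ ((Ttrans n k)^[(i : ℕ) + 1] u) := by
  set w : Fin k → ZMod n := fun j => prependErase 0 i u j - u i with hw
  have hsign : ((Equiv.Perm.sign i.cycleRange : ℤ) : F) = (-1) ^ (i : ℕ) := by
    simp [Fin.sign_cycleRange]
  have hins (x : Fin k → ZMod n) :
      φ (Function.update x i (a - ∑ t, x t)) = (-1) ^ (i : ℕ) * φ (insTuple n a i x) := by
    rw [← prependErase_comp_cycleRange, hφ.1, zsmul_eq_mul, hsign]
    rfl
  have hupd : (fun j => Function.update u i 0 j - u i) = w ∘ i.cycleRange := by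
    rw [← prependErase_comp_cycleRange]
    rfl
  have hrot : fourierT n F ω k φ ((Ttrans n k)^[(i : ℕ) + 1] u) =
      (-1) ^ ((k - 1) * ((i : ℕ) + 1)) * fourierT n F ω k φ w := by
    rw [Ttrans_iterate_eq_comp_finRotate_pow, fourierT_comp_perm ω hφ, map_pow,
      sign_finRotate, ← pow_mul]
    simp [hw]
  have h := fourierT_comp_update hω φ a i u
  simp only [hins] at h
  rw [hupd, fourierT_comp_perm ω hφ, hsign] at h
  have hlin : fourierT n F ω k (fun x => (-1) ^ (i : ℕ) * φ (insTuple n a i x)) u =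
      (-1) ^ (i : ℕ) * fourierT n F ω k (fun x => φ (insTuple n a i x)) u := by
    simp only [fourierT, Finset.mul_sum, mul_assoc]
  rw [hlin, mul_left_comm] at h
  rw [mul_left_cancel₀ (pow_ne_zero _ (neg_ne_zero.mpr one_ne_zero)) h, hrot]
  have hsq : ((-1 : F) ^ ((k - 1) * ((i : ℕ) + 1))) * (-1) ^ ((k - 1) * ((i : ℕ) + 1)) = 1 := by
    rw [← mul_pow]; simp
  linear_combination (-eF n F ω (-(u i * a)) * fourierT n F ω k φ w) * hsq

/-- for alternating `φ` and
`f_a(x) = φ(x) + ∑_{i=1}^k (-1)^i φ(a - ∑_j x_j, x_1,…,x̂_i,…,x_k)`, the Fourier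
transform satisfies `f̂_a(u) = φ̂(u) + ∑_{i=1}^k (-1)^{ki} e(-u_i a) φ̂(T^i u)`. -/
theorem fourier_of_fa (n k : ℕ) [NeZero n] (hk : 0 < k)
    (hcop : Nat.Coprime (k + 1) n) (F : Type*) [Field F]
    (hchar : ¬ (ringChar F ∣ n)) (ω : F) (hω : IsPrimitiveRoot ω n)
    (φ : (Fin k → ZMod n) → F) (hφ : IsAlt n F k φ) (a : ZMod n)
    (u : Fin k → ZMod n) :
    fourierT n F ω k
        (fun x => φ x + ∑ i : Fin k, (-1 : F) ^ ((i : ℕ) + 1) * φ (insTuple n a i x)) u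
      = fourierT n F ω k φ u +
        ∑ i : Fin k, (-1 : F) ^ (k * ((i : ℕ) + 1)) * eF n F ω (-(u i * a)) *
          fourierT n F ω k φ ((Ttrans n k)^[(i : ℕ) + 1] u) := by
  have hsum : fourierT n F ω k
        (fun x => φ x + ∑ i : Fin k, (-1 : F) ^ ((i : ℕ) + 1) * φ (insTuple n a i x)) u
      = fourierT n F ω k φ u + ∑ i : Fin k, (-1 : F) ^ ((i : ℕ) + 1) *
          fourierT n F ω k (fun x => φ (insTuple n a i x)) u := by
    simp only [fourierT, add_mul, Finset.sum_add_distrib, Finset.sum_mul, Finset.mul_sum,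
      mul_assoc]
    rw [Finset.sum_comm]
  rw [hsum]
  congr 1
  refine Finset.sum_congr rfl fun i _ => ?_
  have hpow : (-1 : F) ^ (k * ((i : ℕ) + 1)) =
      (-1) ^ ((i : ℕ) + 1) * (-1) ^ ((k - 1) * ((i : ℕ) + 1)) := by
    obtain ⟨m, rfl⟩ := Nat.exists_eq_succ_of_ne_zero hk.ne'
    rw [← pow_add]
    congr 1
    simp only [Nat.succ_eq_add_one, Nat.add_sub_cancel]
    ring
  rw [fourierT_comp_insTuple hω.pow_eq_one hφ, hpow]
  ring
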